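/- (Epistemic preservation under the Dining Cryptographers abstraction.) Let M, M^a, (E, e₁, e₂), m, m^a and R satisfy the hypotheses: (i) R is a bisimulation between M and M^a; (ii) whenever u R u' then m j u = m^a j u' for all j ∈ Agt; (iii) for every agent i, whenever u ∼^M_i v then m i u = m i v; and (iv) for every agent i, the graph is connected on Agt ∖ {i} using the edges in E ∖ keys(i). Then for every formula φ of the epistemic language L(Var ⊕ {rr}, Agt), every pair of worlds with u R u', and every κ : E → ZMod 2, we have DC(M,m),(u,κ) ⊨ φ if and only if DC^a(M^a,m^a),u' ⊨ φ. Moreover, if in addition every world of M is R-related to some world of M^a and every world of M^a is R-related to some world of M, then φ is valid in DC(M,m) if and only if φ is valid in DC^a(M^a,m^a). -/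

import Mathlib

/-- An epistemic Kripke structure over variables `Var` and agents `Agt`,
with worlds `W`: for each agent an equivalence relation on worlds, and a
Boolean valuation of the variables at each world. -/
structure Kripke (Var Agt W : Type*) where
  rel : Agt → W → W → Prop
  equiv : ∀ i, Equivalence (rel i)
  val : W → Var → Bool

/-- Formulas of the epistemic language `L(Var, Agt)`:
`⊤ | v | ¬φ | φ ∧ φ | K_i φ`. -/
inductive EFormula (Var Agt : Type*) : Type _ where
  | top : EFormula Var Agt
  | var : Var → EFormula Var Agt
  | neg : EFormula Var Agt → EFormula Var Agt
  | and : EFormula Var Agt → EFormula Var Agt → EFormula Var Agt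
  | know : Agt → EFormula Var Agt → EFormula Var Agt

/-- Satisfaction `M, w ⊨ φ`. -/
def Kripke.Sat {Var Agt W : Type*} (M : Kripke Var Agt W) : W → EFormula Var Agt → Prop
  | _, .top => True
  | w, .var v => M.val w v = true
  | w, .neg φ => ¬ M.Sat w φ
  | w, .and φ ψ => M.Sat w φ ∧ M.Sat w ψ
  | w, .know i φ => ∀ w', M.rel i w w' → M.Sat w' φ

/-- A bisimulation between two epistemic Kripke structures over the same
`Var` and `Agt`: the Atoms, Forth and Back conditions. -/
def Bisim {Var Agt W₁ W₂ : Type*} (M : Kripke Var Agt W₁) (N : Kripke Var Agt W₂)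
    (R : W₁ → W₂ → Prop) : Prop :=
  (∀ w u, R w u → ∀ v, M.val w v = N.val u v) ∧
  (∀ i w₁ w₂ u₁, M.rel i w₁ w₂ → R w₁ u₁ → ∃ u₂, N.rel i u₁ u₂ ∧ R w₂ u₂) ∧
  (∀ i u₁ u₂ w₁, N.rel i u₁ u₂ → R w₁ u₁ → ∃ w₂, M.rel i w₁ w₂ ∧ R w₂ u₂)

/-- Validity: `M ⊨ φ` iff `φ` holds at every world of `M`. -/
def Kripke.Valid {Var Agt W : Type*} (M : Kripke Var Agt W) (φ : EFormula Var Agt) : Prop :=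
  ∀ w, M.Sat w φ

/-- The set of edges incident on agent `j` (the keys held by `j`). -/
def dcKeys {Agt E : Type*} (e1 e2 : E → Agt) (j : Agt) : Set E :=
  {ε | e1 ε = j ∨ e2 ε = j}

/-- The exclusive-or (sum in `ZMod 2`) of the values of `d` over the edges
incident on agent `j`. -/
def keySum {Agt E : Type*} [Fintype E] [DecidableEq Agt]
    (e1 e2 : E → Agt) (j : Agt) (d : E → ZMod 2) : ZMod 2 :=
  ∑ ε ∈ Finset.univ.filter (fun ε => e1 ε = j ∨ e2 ε = j), d ε

/-- One step between agents `x` and `y` within the set `S` of agents, along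
an edge from `F` whose two endpoints are `x` and `y`. -/
def EdgeStep {Agt E : Type*} (e1 e2 : E → Agt) (F : Set E) (S : Set Agt)
    (x y : Agt) : Prop :=
  x ∈ S ∧ y ∈ S ∧ ∃ ε ∈ F, (e1 ε = x ∧ e2 ε = y) ∨ (e1 ε = y ∧ e2 ε = x)

/-- The graph is connected on the set `S` of agents using the set `F` of edges:
any two agents of `S` are joined by a finite path of edges from `F` all of
whose agents lie in `S`. -/
def ConnectedOn {Agt E : Type*} (e1 e2 : E → Agt) (S : Set Agt) (F : Set E) : Prop :=
  ∀ x ∈ S, ∀ y ∈ S, Relation.ReflTransGen (EdgeStep e1 e2 F S) x y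

/-- The concrete DC structure `DC(M, m)`: worlds are pairs of a world of `M`
and a key assignment `κ : E → ZMod 2`; agent `i` cannot distinguish two worlds
iff they are `∼_i`-related in `M`, agree on the keys incident on `i`, and give
rise to the same broadcast by each agent; the valuation extends that of `M`
by assigning to the fresh variable `rr` the xor of all messages. -/
def DCconc {Var Agt W E : Type*} [Fintype Agt] [Fintype E] [DecidableEq Agt]
    (M : Kripke Var Agt W) (e1 e2 : E → Agt) (m : Agt → W → ZMod 2) :
    Kripke (Var ⊕ Unit) Agt (W × (E → ZMod 2)) where
  rel i p q := M.rel i p.1 q.1 ∧ (∀ ε ∈ dcKeys e1 e2 i, p.2 ε = q.2 ε) ∧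
    ∀ j, m j p.1 + keySum e1 e2 j p.2 = m j q.1 + keySum e1 e2 j q.2
  equiv i :=
    ⟨fun _ => ⟨(M.equiv i).refl _, fun _ _ => rfl, fun _ => rfl⟩,
     fun h => ⟨(M.equiv i).symm h.1, fun ε hε => (h.2.1 ε hε).symm,
       fun j => (h.2.2 j).symm⟩,
     fun h h' => ⟨(M.equiv i).trans h.1 h'.1,
       fun ε hε => (h.2.1 ε hε).trans (h'.2.1 ε hε),
       fun j => (h.2.2 j).trans (h'.2.2 j)⟩⟩
  val p x :=
    match x with
    | Sum.inl v => M.val p.1 v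
    | Sum.inr _ => decide ((∑ j, m j p.1) = 1)

/-- The abstract DC structure `DCᵃ(Mᵃ, mᵃ)` (trusted third party): the worlds
are unchanged; agent `i` cannot distinguish two worlds iff they are
`∼_i`-related in `Mᵃ` and give the same xor of all messages; the valuation
extends that of `Mᵃ` by assigning the xor of all messages to `rr`. -/
def DCabs {Var Agt Wa : Type*} [Fintype Agt]
    (Ma : Kripke Var Agt Wa) (ma : Agt → Wa → ZMod 2) :
    Kripke (Var ⊕ Unit) Agt Wa where
  rel i u v := Ma.rel i u v ∧ (∑ j, ma j u) = (∑ j, ma j v)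
  equiv i :=
    ⟨fun _ => ⟨(Ma.equiv i).refl _, rfl⟩,
     fun h => ⟨(Ma.equiv i).symm h.1, h.2.symm⟩,
     fun h h' => ⟨(Ma.equiv i).trans h.1 h'.1, h.2.trans h'.2⟩⟩
  val u x :=
    match x with
    | Sum.inl v => Ma.val u v
    | Sum.inr _ => decide ((∑ j, ma j u) = 1)

theorem keySum_add' {Agt E : Type*} [Fintype E] [DecidableEq Agt]
    (e1 e2 : E → Agt) (j : Agt) (a b : E → ZMod 2) :
    keySum e1 e2 j (fun ε => a ε + b ε) = keySum e1 e2 j a + keySum e1 e2 j b := by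
  simp [keySum, Finset.sum_add_distrib]

theorem zmod2_self_add (a : ZMod 2) : a + a = 0 := CharTwo.add_self_eq_zero a

theorem sum_keySum {Agt E : Type*} [Fintype Agt] [Fintype E] [DecidableEq Agt]
    (e1 e2 : E → Agt) (hloop : ∀ ε, e1 ε ≠ e2 ε) (d : E → ZMod 2) :
    ∑ j, keySum e1 e2 j d = 0 := by
  have h : ∀ j, keySum e1 e2 j d =
      ∑ ε, ((if e1 ε = j then d ε else 0) + (if e2 ε = j then d ε else 0)) := by
    intro j
    rw [keySum, Finset.sum_filter]
    refine Finset.sum_congr rfl fun ε _ => ?_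
    by_cases h1 : e1 ε = j
    · have h2 : e2 ε ≠ j := fun h2 => hloop ε (h1.trans h2.symm)
      simp [h1, h2]
    · simp [h1]
  simp_rw [h]
  rw [Finset.sum_comm]
  refine Finset.sum_eq_zero fun ε _ => ?_
  simp [Finset.sum_add_distrib, zmod2_self_add]

theorem path_delta {Agt E : Type*} [Fintype E] [DecidableEq Agt]
    (e1 e2 : E → Agt) (hloop : ∀ ε, e1 ε ≠ e2 ε) (i : Agt) (S : Set Agt) (x y : Agt)
    (h : Relation.ReflTransGen (EdgeStep e1 e2 {ε | ε ∉ dcKeys e1 e2 i} S) x y) :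
    ∃ δ : E → ZMod 2, (∀ ε ∈ dcKeys e1 e2 i, δ ε = 0) ∧
      ∀ j, keySum e1 e2 j δ = (if x = j then 1 else 0) + (if y = j then 1 else 0) := by
  classical
  induction h with
  | refl => exact ⟨fun _ => 0, fun _ _ => rfl, fun j => by simp [keySum, zmod2_self_add]⟩
  | @tail b c _ hs ih =>
    obtain ⟨δ, h0, h1⟩ := ih
    obtain ⟨_, _, ε, hε, hends⟩ := hs
    refine ⟨fun ε' => δ ε' + (if ε' = ε then 1 else 0), ?_, ?_⟩
    · intro ε' hε'
      have : ε' ≠ ε := by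
        rintro rfl
        exact hε hε'
      simp [h0 ε' hε', this]
    · intro j
      have hk : keySum e1 e2 j (fun ε' => if ε' = ε then 1 else 0)
          = (if b = j then 1 else 0) + (if c = j then 1 else 0) := by
        have hl := hloop ε
        have hk0 : keySum e1 e2 j (fun ε' => if ε' = ε then 1 else 0)
          = if e1 ε = j ∨ e2 ε = j then 1 else 0 := by
          simp [keySum, Finset.sum_ite_eq']
        rw [hk0]
        rcases hends with ⟨rfl, rfl⟩ | ⟨rfl, rfl⟩
        · by_cases h1 : e1 ε = j
          · have h2 : e2 ε ≠ j := fun h2 => hl (h1.trans h2.symm)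
            simp [h1, h2]
          · simp [h1]
        · by_cases h1 : e1 ε = j
          · have h2 : e2 ε ≠ j := fun h2 => hl (h1.trans h2.symm)
            simp [h1, h2]
          · simp [h1]
      rw [keySum_add', h1, hk]
      have := zmod2_self_add (if b = j then (1 : ZMod 2) else 0)
      linear_combination this

theorem exists_delta {Agt E : Type*} [Fintype Agt] [Fintype E] [DecidableEq Agt]
    (e1 e2 : E → Agt) (hloop : ∀ ε, e1 ε ≠ e2 ε) (i : Agt)
    (hconn : ConnectedOn e1 e2 {j | j ≠ i} {ε | ε ∉ dcKeys e1 e2 i})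
    (d : Agt → ZMod 2) (hdi : d i = 0) (hd : ∑ j, d j = 0) :
    ∃ δ : E → ZMod 2, (∀ ε ∈ dcKeys e1 e2 i, δ ε = 0) ∧ ∀ j, keySum e1 e2 j δ = d j := by
  by_cases hr : ∃ r, r ≠ i
  · obtain ⟨r, hr⟩ := hr
    have hx : ∀ x, ∃ δ : E → ZMod 2, x ≠ i → (∀ ε ∈ dcKeys e1 e2 i, δ ε = 0) ∧
        ∀ j, keySum e1 e2 j δ = (if x = j then 1 else 0) + (if r = j then 1 else 0) := by
      intro x
      by_cases hxi : x = i
      · exact ⟨0, fun h => absurd hxi h⟩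
      · obtain ⟨δ, h⟩ := path_delta e1 e2 hloop i _ x r (hconn x hxi r hr)
        exact ⟨δ, fun _ => h⟩
    choose δ hδ using hx
    refine ⟨fun ε => ∑ x, d x * δ x ε, ?_, ?_⟩
    · intro ε hε
      refine Finset.sum_eq_zero fun x _ => ?_
      by_cases hxi : x = i
      · simp [hxi, hdi]
      · simp [(hδ x hxi).1 ε hε]
    · intro j
      have h1 : keySum e1 e2 j (fun ε => ∑ x, d x * δ x ε)
          = ∑ x, d x * keySum e1 e2 j (δ x) := by
        simp only [keySum, Finset.mul_sum]
        rw [Finset.sum_comm]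
      have h2 : ∀ x, d x * keySum e1 e2 j (δ x)
          = (if x = j then d x else 0) + d x * (if r = j then 1 else 0) := by
        intro x
        by_cases hxi : x = i
        · subst hxi
          simp [hdi]
        · rw [(hδ x hxi).2 j, mul_add]
          simp
      rw [h1, Finset.sum_congr rfl fun x _ => h2 x, Finset.sum_add_distrib, ← Finset.sum_mul, hd]
      simp
  · push Not at hr
    refine ⟨fun _ => 0, fun _ _ => rfl, fun j => ?_⟩
    rw [hr j, hdi]
    simp [keySum]

/-- epistemic preservation under the Dining Cryptographers
abstraction: under hypotheses (i)–(iv), every formula of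
`L(Var ⊕ {rr}, Agt)` has the same truth value at `(u,κ)` in `DC(M,m)` as at
`u'` in `DCᵃ(Mᵃ,mᵃ)` whenever `R u u'`; moreover, if `R` is total in both
directions then validity in the two structures coincides. -/
theorem dc_abstraction_preserves {Var Agt W Wa E : Type*}
    [Fintype Agt] [Fintype E] [DecidableEq Agt]
    (M : Kripke Var Agt W) (Ma : Kripke Var Agt Wa)
    (e1 e2 : E → Agt) (hloop : ∀ ε, e1 ε ≠ e2 ε)
    (m : Agt → W → ZMod 2) (ma : Agt → Wa → ZMod 2)
    (R : W → Wa → Prop)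
    (hbisim : Bisim M Ma R)
    (hmsg : ∀ u u', R u u' → ∀ j, m j u = ma j u')
    (hown : ∀ i u v, M.rel i u v → m i u = m i v)
    (hconn : ∀ i, ConnectedOn e1 e2 {j | j ≠ i} {ε | ε ∉ dcKeys e1 e2 i}) :
    (∀ (φ : EFormula (Var ⊕ Unit) Agt) (u : W) (u' : Wa), R u u' →
      ∀ κ : E → ZMod 2,
        ((DCconc M e1 e2 m).Sat (u, κ) φ ↔ (DCabs Ma ma).Sat u' φ)) ∧
    ((∀ u, ∃ u', R u u') → (∀ u', ∃ u, R u u') →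
      ∀ φ : EFormula (Var ⊕ Unit) Agt,
        ((DCconc M e1 e2 m).Valid φ ↔ (DCabs Ma ma).Valid φ)) := by
  have main : ∀ (φ : EFormula (Var ⊕ Unit) Agt) (u : W) (u' : Wa), R u u' →
      ∀ κ : E → ZMod 2,
        ((DCconc M e1 e2 m).Sat (u, κ) φ ↔ (DCabs Ma ma).Sat u' φ) := by
    obtain ⟨hat, hforth, hback⟩ := hbisim
    have hsum : ∀ u u', R u u' → ∑ j, m j u = ∑ j, ma j u' := fun u u' h =>
      Finset.sum_congr rfl fun j _ => hmsg u u' h j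
    intro φ
    induction φ with
    | top => intros; simp [Kripke.Sat]
    | var v =>
      intro u u' h κ
      rcases v with v | v
      · simp [Kripke.Sat, DCconc, DCabs, hat u u' h v]
      · simp [Kripke.Sat, DCconc, DCabs, hsum u u' h]
    | neg φ ih =>
      intro u u' h κ
      simp only [Kripke.Sat]
      rw [ih u u' h κ]
    | and φ ψ ih1 ih2 =>
      intro u u' h κ
      simp only [Kripke.Sat]
      rw [ih1 u u' h κ, ih2 u u' h κ]
    | know i φ ih =>
      intro u u' h κ
      simp only [Kripke.Sat]
      constructor
      · rintro hK v' ⟨hrel, hs⟩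
        obtain ⟨v, hv, hR⟩ := hback i u' v' u hrel h
        obtain ⟨δ, hδ0, hδ⟩ := exists_delta e1 e2 hloop i (hconn i)
          (fun j => m j u - m j v) (by simp [hown i u v hv])
          (by rw [Finset.sum_sub_distrib, hsum u u' h, hsum v v' hR, hs, sub_self])
        refine (ih v v' hR (fun ε => κ ε + δ ε)).1 (hK _ ⟨hv, ?_, ?_⟩)
        · intro ε hε
          simp [hδ0 ε hε]
        · intro j
          simp only [keySum_add', hδ]
          ring
      · rintro hK ⟨v, l⟩ ⟨hrel, _, hs⟩
        obtain ⟨v', hv, hR⟩ := hforth i u v u' hrel h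
        refine (ih v v' hR l).2 (hK v' ⟨hv, ?_⟩)
        rw [← hsum u u' h, ← hsum v v' hR]
        have := Finset.sum_congr (rfl : (Finset.univ : Finset Agt) = Finset.univ)
          fun j _ => hs j
        simpa [Finset.sum_add_distrib, sum_keySum e1 e2 hloop] using this
  refine ⟨main, fun hl hr φ => ⟨fun hv u' => ?_, fun hv p => ?_⟩⟩
  · obtain ⟨u, h⟩ := hr u'
    exact (main φ u u' h (fun _ => 0)).1 (hv _)
  · obtain ⟨u', h⟩ := hl p.1
    exact (main φ p.1 u' h p.2).2 (hv _)
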